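/- arXiv:1708.04992 — 2 statements merged into one kernel-verified Lean document; each statement's English description precedes it below -/
import Mathlib

section
/- The operators Ĝ_n satisfy the commutation relations of the untwisted Heisenberg algebra ℋ_ℤ with negative-definite form: for all m, n ∈ ℤ, Ĝ_m ∘ Ĝ_n − Ĝ_n ∘ Ĝ_m = −m • id if m + n = 0, and Ĝ_m ∘ Ĝ_n − Ĝ_n ∘ Ĝ_m = 0 otherwise. (That is, the modes h^ℤ_n, n ∈ ℤ, of the untwisted Heisenberg field constructed from the CKP field χ(z) satisfy [h^ℤ_m, h^ℤ_n] = −m δ_{m+n,0}·1.) -/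
open MvPolynomial

/-- The mode `χ̂_m` of the CKP generating field `χ(z)` acting on the Fock space
`R = MvPolynomial ℕ ℂ`: for `m ≥ 0` it is `(−1)^m • ∂_{X_m}`, and for `m < 0` it is
multiplication by `X_{−m−1}`. -/
noncomputable def chiHat (m : ℤ) : MvPolynomial ℕ ℂ →ₗ[ℂ] MvPolynomial ℕ ℂ :=
  if 0 ≤ m then ((-1 : ℂ) ^ m.toNat) • (pderiv (R := ℂ) m.toNat).toLinearMap
  else LinearMap.mulLeft ℂ (X (-m - 1).toNat)

/-- Normal ordering `:χ̂_m χ̂_n:`. -/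
noncomputable def normalOrder (m n : ℤ) : MvPolynomial ℕ ℂ →ₗ[ℂ] MvPolynomial ℕ ℂ :=
  if 0 ≤ m ∧ n < 0 then chiHat n ∘ₗ chiHat m else chiHat m ∘ₗ chiHat n

/-- The untwisted Heisenberg mode `Ĝ_n = (1/2) ∑_{c∈ℤ} :χ̂_c χ̂_{2n−1−c}:`, realizing the
mode `h^ℤ_n` of the untwisted Heisenberg field
`h^ℤ_χ(z) = (1/(4z))(:χ(z)χ(z): − :χ(−z)χ(−z):)`. -/
noncomputable def Ghat (n : ℤ) (P : MvPolynomial ℕ ℂ) : MvPolynomial ℕ ℂ :=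
  (1/2 : ℂ) • ∑ᶠ c : ℤ, normalOrder c (2*n - 1 - c) P

theorem chiHat_of_nonneg {k : ℤ} (hk : 0 ≤ k) (P : MvPolynomial ℕ ℂ) :
    chiHat k P = ((-1 : ℂ) ^ k) • pderiv k.toNat P := by
  lift k to ℕ using hk
  simp [chiHat]

theorem chiHat_of_neg {k : ℤ} (hk : k < 0) (P : MvPolynomial ℕ ℂ) :
    chiHat k P = X (-k - 1).toNat * P := by
  simp [chiHat, not_le.mpr hk]

theorem chiHat_neg_natCast (i : ℕ) (P : MvPolynomial ℕ ℂ) :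
    chiHat (-(i : ℤ) - 1) P = X i * P := by
  rw [chiHat_of_neg (by lia)]
  congr 2
  lia

theorem chiHat_one_of_nonneg {k : ℤ} (hk : 0 ≤ k) : chiHat k 1 = 0 := by
  simp [chiHat_of_nonneg hk]

theorem constantCoeff_chiHat_of_neg {k : ℤ} (hk : k < 0) (P : MvPolynomial ℕ ℂ) :
    constantCoeff (chiHat k P) = 0 := by
  simp [chiHat_of_neg hk]

theorem exists_chiHat_eq_zero (P : MvPolynomial ℕ ℂ) :
    ∃ N : ℤ, ∀ k, N ≤ k → chiHat k P = 0 := by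
  refine ⟨(P.vars.sup id : ℕ) + 1, fun k hk => ?_⟩
  rw [chiHat_of_nonneg (by lia), pderiv_eq_zero_of_notMem_vars, smul_zero]
  intro h
  have := Finset.le_sup (f := id) h
  simp only [id] at this
  lia

theorem pderiv_comm (i j : ℕ) (P : MvPolynomial ℕ ℂ) :
    pderiv i (pderiv j P) = pderiv j (pderiv i P) := by
  ext s
  rcases eq_or_ne i j with rfl | h
  · rfl
  · simp only [coeff_pderiv, Finsupp.add_apply, Finsupp.single_apply, if_neg h, if_neg h.symm,
      add_right_comm s (Finsupp.single i 1)]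
    push_cast
    ring

/-- The commutation relation of the modes of the CKP field. -/
theorem chiHat_chiHat (m n : ℤ) (P : MvPolynomial ℕ ℂ) :
    chiHat m (chiHat n P) =
      chiHat n (chiHat m P) + (if m + n + 1 = 0 then (-1 : ℂ) ^ m else 0) • P := by
  rcases le_or_gt 0 m with hm | hm <;> rcases le_or_gt 0 n with hn | hn
  · rw [if_neg (by lia)]
    simp only [chiHat_of_nonneg hm, chiHat_of_nonneg hn, Derivation.map_smul, zero_smul, add_zero]
    rw [smul_comm, pderiv_comm]
  · simp only [chiHat_of_nonneg hm, chiHat_of_neg hn, pderiv_mul, pderiv_X, Pi.single_apply]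
    split_ifs with h₁ h₂ h₂
    · simp [add_comm]
    · lia
    · lia
    · simp
  · simp only [chiHat_of_nonneg hn, chiHat_of_neg hm, pderiv_mul, pderiv_X, Pi.single_apply]
    split_ifs with h₁ h₂ h₂
    · have : (-1 : ℂ) ^ n = -(-1) ^ m := by
        rw [show n = -(m + 1) by lia, zpow_neg, ← inv_zpow, zpow_add₀ (by norm_num)]
        norm_num
      rw [this]
      simp
    · lia
    · lia
    · simp
  · rw [if_neg (by lia)]
    simp only [chiHat_of_neg hm, chiHat_of_neg hn]
    simp [mul_left_comm]

theorem normalOrder_chiHat (c d k : ℤ) (P : MvPolynomial ℕ ℂ) :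
    normalOrder c d (chiHat k P) = chiHat k (normalOrder c d P) +
      ((if c + k + 1 = 0 then (-1 : ℂ) ^ c else 0) • chiHat d P +
        (if d + k + 1 = 0 then (-1 : ℂ) ^ d else 0) • chiHat c P) := by
  unfold normalOrder
  split_ifs <;>
  simp only [LinearMap.comp_apply, chiHat_chiHat d k, chiHat_chiHat c k, map_add, map_smul] <;>
  simp [*] <;> abel

theorem normalOrder_one {c d : ℤ} (h : 0 ≤ c ∨ 0 ≤ d) : normalOrder c d 1 = 0 := by
  unfold normalOrder
  split_ifs with hs
  · simp [chiHat_one_of_nonneg hs.1]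
  · rw [LinearMap.comp_apply, chiHat_one_of_nonneg (by lia), map_zero]

theorem constantCoeff_normalOrder {c d : ℤ} (h : c < 0 ∨ d < 0) (P : MvPolynomial ℕ ℂ) :
    constantCoeff (normalOrder c d P) = 0 := by
  unfold normalOrder
  split_ifs with hs
  · exact constantCoeff_chiHat_of_neg hs.2 _
  · exact constantCoeff_chiHat_of_neg (by lia) _

theorem hasFiniteSupport_normalOrder (s : ℤ) (P : MvPolynomial ℕ ℂ) :
    (fun c : ℤ => normalOrder c (s - c) P).HasFiniteSupport := by
  obtain ⟨N, hN⟩ := exists_chiHat_eq_zero P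
  refine (Set.finite_Icc (s - max N (max 0 (s + 1))) (max N (max 0 (s + 1)))).subset
    fun c hc => ?_
  by_contra h
  refine hc ?_
  simp only [Set.mem_Icc, not_and_or, not_le] at h
  dsimp only
  unfold normalOrder
  split_ifs with hs <;> rw [LinearMap.comp_apply, hN _ (by lia), map_zero]

theorem hasFiniteSupport_map_normalOrder (f : MvPolynomial ℕ ℂ →ₗ[ℂ] MvPolynomial ℕ ℂ) (s : ℤ)
    (P : MvPolynomial ℕ ℂ) : (fun c : ℤ => f (normalOrder c (s - c) P)).HasFiniteSupport :=
  (hasFiniteSupport_normalOrder s P).subset (Function.support_comp_subset (map_zero f) _)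

/-- `Ghat` as a linear map. -/
noncomputable def GhatLin (n : ℤ) : MvPolynomial ℕ ℂ →ₗ[ℂ] MvPolynomial ℕ ℂ where
  toFun := Ghat n
  map_add' P Q := by
    simp only [Ghat, map_add]
    rw [finsum_add_distrib (hasFiniteSupport_normalOrder _ P) (hasFiniteSupport_normalOrder _ Q),
      smul_add]
  map_smul' r P := by
    simp only [Ghat, map_smul, RingHom.id_apply]
    rw [← smul_finsum, smul_comm]

theorem GhatLin_apply (n : ℤ) (P : MvPolynomial ℕ ℂ) :
    GhatLin n P = (1/2 : ℂ) • ∑ᶠ c : ℤ, normalOrder c (2*n - 1 - c) P := rfl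

theorem GhatLin_chiHat (n k : ℤ) (P : MvPolynomial ℕ ℂ) :
    GhatLin n (chiHat k P) =
      chiHat k (GhatLin n P) + (-1 : ℂ) ^ (k + 1) • chiHat (k + 2 * n) P := by
  have hsign : (-1 : ℂ) ^ (-k - 1) = (-1) ^ (k + 1) := by
    rw [show -k - 1 = -(k + 1) by ring, zpow_neg, ← inv_zpow]
    norm_num
  have hone : ∀ c ≠ -k - 1,
      (if c + k + 1 = 0 then (-1 : ℂ) ^ c else 0) • chiHat (2 * n - 1 - c) P = 0 := by
    intro c hc
    rw [if_neg (by lia), zero_smul]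
  have htwo : ∀ c ≠ 2 * n + k,
      (if 2 * n - 1 - c + k + 1 = 0 then (-1 : ℂ) ^ (2 * n - 1 - c) else 0) • chiHat c P = 0 := by
    intro c hc
    rw [if_neg (by lia), zero_smul]
  have fone := (Set.finite_singleton (-k - 1)).subset
    (Function.support_subset_iff'.mpr hone)
  have ftwo := (Set.finite_singleton (2 * n + k)).subset
    (Function.support_subset_iff'.mpr htwo)
  have fsum := (fone.union ftwo).subset (Function.support_add _ _)
  have fP := hasFiniteSupport_normalOrder (2 * n - 1) P
  simp only [GhatLin_apply, normalOrder_chiHat]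
  rw [finsum_add_distrib (hasFiniteSupport_map_normalOrder (chiHat k) _ P) fsum,
    finsum_add_distrib fone ftwo, finsum_eq_single _ _ hone, finsum_eq_single _ _ htwo,
    map_smul, map_finsum (chiHat k) fP, if_pos (by ring), if_pos (by ring),
    show 2 * n - 1 - (2 * n + k) = -k - 1 by ring, show 2 * n - 1 - (-k - 1) = k + 2 * n by ring,
    add_comm (2 * n) k, hsign]
  module

theorem GhatLin_one_of_nonneg {n : ℤ} (hn : 0 ≤ n) : GhatLin n 1 = 0 := by
  have h (c : ℤ) : normalOrder c (2 * n - 1 - c) 1 = 0 :=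
    normalOrder_one (by lia)
  simp [GhatLin_apply, h]

theorem constantCoeff_GhatLin_of_nonpos {n : ℤ} (hn : n ≤ 0) (P : MvPolynomial ℕ ℂ) :
    constantCoeff (GhatLin n P) = 0 := by
  have h (c : ℤ) : constantCoeff (normalOrder c (2 * n - 1 - c) P) = 0 :=
    constantCoeff_normalOrder (by lia) _
  rw [GhatLin_apply, constantCoeff_smul,
    map_finsum _ (hasFiniteSupport_normalOrder (2 * n - 1) P)]
  simp [h]

theorem constantCoeff_GhatLin_GhatLin_one {m n : ℤ} (hm : 0 ≤ m) (hn : n < 0) :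
    constantCoeff (GhatLin m (GhatLin n 1)) = if m + n = 0 then -(m : ℂ) else 0 := by
  have key (c : ℤ) : constantCoeff (GhatLin m (normalOrder c (2 * n - 1 - c) 1)) =
      if c ∈ Finset.Ico (2 * n) 0 then (if m + n = 0 then (-1 : ℂ) else 0) else 0 := by
    simp only [Finset.mem_Ico]
    split_ifs with hc hmn
    all_goals first
      | (rw [normalOrder_one (by lia)]; simp)
      | (rw [normalOrder, if_neg (by lia), LinearMap.comp_apply, GhatLin_chiHat, chiHat_chiHat,
          map_add, constantCoeff_chiHat_of_neg hc.2, constantCoeff_smul, map_add,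
          constantCoeff_chiHat_of_neg (by lia)])
    · rw [if_pos (by lia), constantCoeff_smul, zpow_add₀ (by norm_num), zpow_add₀ (by norm_num),
        zpow_mul]
      have : ((-1 : ℂ) ^ c) * (-1) ^ c = 1 := by rw [← mul_zpow]; norm_num
      simp only [map_one, smul_eq_mul]
      norm_num
      linear_combination this
    · rw [if_neg (by lia)]
      simp
  rw [GhatLin_apply n, map_smul, constantCoeff_smul,
    map_finsum (GhatLin m) (hasFiniteSupport_normalOrder (2 * n - 1) 1),
    map_finsum constantCoeff (hasFiniteSupport_map_normalOrder (GhatLin m) _ 1),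
    finsum_congr key, finsum_eq_sum_of_support_subset (s := Finset.Ico (2 * n) 0) _ (by
      intro c hc
      by_contra h
      exact hc (if_neg h)),
    Finset.sum_congr rfl (fun c hc => if_pos hc), Finset.sum_const, Int.card_Ico]
  split_ifs with h
  · have h₂ : (((0 - 2 * n).toNat : ℕ) : ℂ) = 2 * m := by
      have : (((0 - 2 * n).toNat : ℕ) : ℤ) = 2 * m := by lia
      exact_mod_cast this
    rw [nsmul_eq_mul, h₂, smul_eq_mul]
    ring
  · simp

theorem eq_C_of_pderiv_eq_zero {P : MvPolynomial ℕ ℂ} (h : ∀ i, pderiv i P = 0) :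
    P = C (constantCoeff P) := by
  ext s
  rw [coeff_C]
  split_ifs with hs
  · rw [← hs, constantCoeff_eq]
  · obtain ⟨i, hi⟩ := Finsupp.ne_iff.mp (Ne.symm hs)
    have hle : Finsupp.single i 1 ≤ s := by
      rw [Finsupp.single_le_iff]
      exact Nat.one_le_iff_ne_zero.mpr hi
    have := congrArg (coeff (s - Finsupp.single i 1)) (h i)
    rw [coeff_pderiv, tsub_add_cancel_of_le hle, coeff_zero, mul_eq_zero] at this
    refine this.resolve_right ?_
    exact Nat.cast_add_one_ne_zero _

/-- A Schur lemma for the CKP Fock space: an operator commuting with all modes is a scalar. -/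
theorem eq_constantCoeff_smul_of_commute_chiHat (K : MvPolynomial ℕ ℂ →ₗ[ℂ] MvPolynomial ℕ ℂ)
    (hK : ∀ k P, K (chiHat k P) = chiHat k (K P)) (P : MvPolynomial ℕ ℂ) :
    K P = constantCoeff (K 1) • P := by
  have hone : K 1 = C (constantCoeff (K 1)) := by
    refine eq_C_of_pderiv_eq_zero fun i => ?_
    have h := hK i 1
    rw [chiHat_one_of_nonneg (by lia), map_zero, chiHat_of_nonneg (by lia)] at h
    exact (smul_eq_zero.mp h.symm).resolve_left (zpow_ne_zero _ (by norm_num))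
  induction P using MvPolynomial.induction_on with
  | C a =>
    rw [C_eq_smul_one, map_smul, smul_comm]
    congr 1
    rw [hone, constantCoeff_C, C_eq_smul_one]
  | add P Q hP hQ => rw [map_add, hP, hQ, smul_add]
  | mul_X P i hP =>
    rw [mul_comm, ← chiHat_neg_natCast, hK, hP, map_smul]

theorem constantCoeff_commutator_one (m n : ℤ) :
    constantCoeff (GhatLin m (GhatLin n 1)) - constantCoeff (GhatLin n (GhatLin m 1)) =
      if m + n = 0 then -(m : ℂ) else 0 := by
  rcases le_or_gt 0 m with hm | hm <;> rcases le_or_gt 0 n with hn | hn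
  · rw [GhatLin_one_of_nonneg hm, GhatLin_one_of_nonneg hn]
    split_ifs with h
    · simp [show m = 0 by lia]
    · simp
  · rw [constantCoeff_GhatLin_GhatLin_one hm hn, constantCoeff_GhatLin_of_nonpos hn.le, sub_zero]
  · rw [constantCoeff_GhatLin_GhatLin_one hn hm, constantCoeff_GhatLin_of_nonpos hm.le, add_comm]
    split_ifs with h
    · simp [show n = -m by lia]
    · simp
  · rw [constantCoeff_GhatLin_of_nonpos hm.le, constantCoeff_GhatLin_of_nonpos hn.le,
      if_neg (by lia), sub_zero]

/-- **Untwisted Heisenberg commutation relations:** the modes `h^ℤ_n`, `n ∈ ℤ`, of the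
untwisted Heisenberg field constructed from the CKP field `χ(z)` satisfy
`[h^ℤ_m, h^ℤ_n] = −m δ_{m+n,0}·1`. -/
theorem ckp_untwisted_heisenberg_relations (m n : ℤ) (P : MvPolynomial ℕ ℂ) :
    Ghat m (Ghat n P) - Ghat n (Ghat m P)
      = (if m + n = 0 then -(m : ℂ) else 0) • P := by
  have h := eq_constantCoeff_smul_of_commute_chiHat
    (GhatLin m ∘ₗ GhatLin n - GhatLin n ∘ₗ GhatLin m) (fun k Q => by
      have hsign (l : ℤ) : (-1 : ℂ) ^ (k + 2 * l + 1) = (-1) ^ (k + 1) := by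
        rw [show k + 2 * l + 1 = k + 1 + 2 * l by ring, zpow_add₀ (by norm_num), zpow_mul]
        norm_num
      simp only [LinearMap.sub_apply, LinearMap.comp_apply, GhatLin_chiHat, map_add, map_smul,
        map_sub, hsign, add_right_comm k (2 * n) (2 * m)]
      module) P
  rw [LinearMap.sub_apply, LinearMap.sub_apply, map_sub] at h
  simp only [LinearMap.comp_apply, constantCoeff_commutator_one] at h
  exact h
end

section
/- For every a ∈ ℤ, L^t_0 ∘ Ĥ_a − Ĥ_a ∘ L^t_0 = −(a + 1/2) • Ĥ_a. (That is, [L^t_0, h^t_n] = −n h^t_n for all n ∈ ℤ+1/2.) -/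
open MvPolynomial

/-- The twisted Heisenberg mode `Ĥ_a = (1/2) ∑_{c∈ℤ} (−1)^{c+1} χ̂_{2a−c} ∘ χ̂_c`,
realizing the mode `h^t_{a+1/2}` of the twisted Heisenberg field
`h^{ℤ+1/2}_χ(z) = (1/2):χ(z)χ(−z):`. -/
noncomputable def Hhat (a : ℤ) (P : MvPolynomial ℕ ℂ) : MvPolynomial ℕ ℂ :=
  (1/2 : ℂ) • ∑ᶠ c : ℤ, (-1 : ℂ) ^ (c + 1) • chiHat (2*a - c) (chiHat c P)

/-- The grading operator `L^t_0 = −∑_{n∈ℤ+1/2, n>0} h^t_{−n} h^t_n`, the zero mode of the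
Virasoro field `L^χ(z)` shifted by `−1/16`. -/
noncomputable def Lt0 (P : MvPolynomial ℕ ℂ) : MvPolynomial ℕ ℂ :=
  -∑ᶠ a : ℕ, Hhat (-(a : ℤ) - 1) (Hhat (a : ℤ) P)

/-- The mode `χ̂_n` for `n ≥ 0` is a signed partial derivative. -/
lemma chiHat_natCast (n : ℕ) (P : MvPolynomial ℕ ℂ) :
    chiHat (n : ℤ) P = (-1 : ℂ) ^ n • pderiv n P := by
  simp [chiHat]

/-- The mode `χ̂_{-n-1}` for `n ≥ 0` is multiplication by `X_n`. -/
lemma chiHat_negSucc (n : ℕ) (P : MvPolynomial ℕ ℂ) :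
    chiHat (Int.negSucc n) P = X n * P := by
  have h : (-Int.negSucc n - 1).toNat = n := by omega
  have h' : ¬ (0 ≤ Int.negSucc n) := by omega
  rw [chiHat, if_neg h', h, LinearMap.mulLeft_apply]

lemma chiHat_commutator (m n : ℤ) (P : MvPolynomial ℕ ℂ) :
    chiHat m (chiHat n P) - chiHat n (chiHat m P)
      = if m + n + 1 = 0 then (-1 : ℂ) ^ m • P else 0 := by
  rcases m with m | m <;> rcases n with n | n <;>
    simp only [Int.ofNat_eq_natCast, chiHat_natCast, chiHat_negSucc]
  · rw [if_neg (by omega), (pderiv (R := ℂ) m).map_smul, (pderiv (R := ℂ) n).map_smul, smul_comm]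
    have h : pderiv m (pderiv n P) = pderiv n (pderiv m P) := by
      have h0 : ⁅pderiv (R := ℂ) m, pderiv (R := ℂ) n⁆ = 0 := by
        apply MvPolynomial.derivation_ext
        intro i
        simp [Derivation.commutator_apply, pderiv_X, Pi.single_apply, apply_ite]
      have := congrArg (fun D => D P) h0
      simpa [Derivation.commutator_apply, sub_eq_zero] using this
    rw [h, sub_self]
  · rw [Derivation.leibniz, pderiv_X]
    by_cases h : m = n
    · subst h
      rw [if_pos (by omega)]
      simp
    · rw [if_neg (by omega)]
      simp [Pi.single_eq_of_ne (Ne.symm h)]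
  · rw [Derivation.leibniz, pderiv_X]
    by_cases h : m = n
    · subst h
      rw [if_pos (by omega)]
      have : (-1 : ℂ) ^ (Int.negSucc m) = -(-1) ^ m := by
        rw [zpow_negSucc, pow_succ, mul_neg_one, inv_neg, ← inv_pow, inv_neg_one]
      simp [this]
    · rw [if_neg (by omega)]
      simp [Pi.single_eq_of_ne h]
  · rw [if_neg (by omega), mul_left_comm, sub_self]

lemma chiHat_comm {m n : ℤ} (h : m + n + 1 ≠ 0) (P : MvPolynomial ℕ ℂ) :
    chiHat m (chiHat n P) = chiHat n (chiHat m P) := by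
  have := chiHat_commutator m n P
  rwa [if_neg h, sub_eq_zero] at this

lemma exists_forall_chiHat_eq_zero (P : MvPolynomial ℕ ℂ) :
    ∃ N : ℤ, ∀ m, N ≤ m → chiHat m P = 0 := by
  refine ⟨(P.vars.sup id + 1 : ℕ), fun m hm => ?_⟩
  lift m to ℕ using by omega
  rw [chiHat_natCast, pderiv_eq_zero_of_notMem_vars, smul_zero]
  intro h
  have : m ≤ P.vars.sup id := Finset.le_sup (f := id) h
  omega

/-- The quadratic sums `∑_c ± χ̂_{s-c} χ̂_c` are locally finite unless `s = -1`. -/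
lemma finite_support_chiHat_chiHat {s : ℤ} (hs : s + 1 ≠ 0) (P : MvPolynomial ℕ ℂ) :
    (Function.support fun c : ℤ => (-1 : ℂ) ^ (c + 1) • chiHat (s - c) (chiHat c P)).Finite := by
  obtain ⟨N, hN⟩ := exists_forall_chiHat_eq_zero P
  refine (Set.finite_Icc (s - N) N).subset fun c hc => ?_
  rw [Function.mem_support] at hc
  by_contra h
  apply hc
  by_cases h1 : N ≤ c
  · rw [hN c h1, map_zero, smul_zero]
  · rw [chiHat_comm (by omega), hN (s - c) (by rw [Set.mem_Icc] at h; omega), map_zero, smul_zero]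

lemma finite_support_linearMap_comp {ι R M N : Type*} [Semiring R] [AddCommMonoid M]
    [AddCommMonoid N] [Module R M] [Module R N] (f : M →ₗ[R] N) {g : ι → M}
    (hg : (Function.support g).Finite) : (Function.support fun i => f (g i)).Finite :=
  hg.subset (Function.support_comp_subset (map_zero f) g)

lemma Hhat_add (a : ℤ) (P Q : MvPolynomial ℕ ℂ) : Hhat a (P + Q) = Hhat a P + Hhat a Q := by
  simp only [Hhat, map_add, smul_add]
  rw [finsum_add_distrib (finite_support_chiHat_chiHat (by omega) P)
    (finite_support_chiHat_chiHat (by omega) Q), smul_add]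

lemma Hhat_smul (a : ℤ) (t : ℂ) (P : MvPolynomial ℕ ℂ) : Hhat a (t • P) = t • Hhat a P := by
  simp only [Hhat, map_smul, smul_comm _ t]
  rw [← smul_finsum, smul_comm]

/-- `Ĥ_a` as a linear map. -/
noncomputable def HhatLinear (a : ℤ) : MvPolynomial ℕ ℂ →ₗ[ℂ] MvPolynomial ℕ ℂ where
  toFun := Hhat a
  map_add' := Hhat_add a
  map_smul' := Hhat_smul a

lemma HhatLinear_apply (a : ℤ) (P : MvPolynomial ℕ ℂ) : HhatLinear a P = Hhat a P := rfl

lemma Hhat_zero (a : ℤ) : Hhat a 0 = 0 := map_zero (HhatLinear a)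

lemma Hhat_chiHat_commutator (a n : ℤ) (P : MvPolynomial ℕ ℂ) :
    Hhat a (chiHat n P) - chiHat n (Hhat a P) = -chiHat (n + 2 * a + 1) P := by
  have hsign : (-1 : ℂ) ^ (n + 1) * (-1) ^ n = -1 := by
    rw [zpow_add_one₀ (by norm_num), mul_right_comm, ← mul_zpow]
    norm_num
  have key : ∀ c : ℤ, (-1 : ℂ) ^ (c + 1) • chiHat (2 * a - c) (chiHat c (chiHat n P))
      - chiHat n ((-1 : ℂ) ^ (c + 1) • chiHat (2 * a - c) (chiHat c P))
      = (if c = -n - 1 then -chiHat (n + 2 * a + 1) P else 0)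
        + (if c = n + 2 * a + 1 then -chiHat (n + 2 * a + 1) P else 0) := by
    intro c
    have h1 := chiHat_commutator c n P
    have h2 := chiHat_commutator (2 * a - c) n (chiHat c P)
    rw [map_smul, ← smul_sub]
    rw [sub_eq_iff_eq_add] at h1
    rw [h1, map_add, add_sub_assoc, h2, smul_add]
    congr 1
    · by_cases h : c = -n - 1
      · subst h
        rw [if_pos (by ring), if_pos rfl, map_smul, smul_smul]
        have h3 : (-1 : ℂ) ^ (-n - 1 + 1) * (-1) ^ (-n - 1) = -1 := by
          rw [show -n - 1 + 1 = -n by ring, show -n - 1 = -(n + 1) by ring, zpow_neg, zpow_neg,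
            ← mul_inv, mul_comm, hsign]
          norm_num
        rw [h3, neg_one_smul]
        congr 3
        ring
      · rw [if_neg (by omega), if_neg h, map_zero, smul_zero]
    · by_cases h : c = n + 2 * a + 1
      · subst h
        rw [if_pos (by ring), if_pos rfl, smul_smul]
        have h3 : (-1 : ℂ) ^ (n + 2 * a + 1 + 1) * (-1) ^ (2 * a - (n + 2 * a + 1)) = -1 := by
          rw [← zpow_add₀ (by norm_num)]
          rw [show n + 2 * a + 1 + 1 + (2 * a - (n + 2 * a + 1)) = 2 * a + 1 by ring]
          exact Odd.neg_one_zpow ⟨a, rfl⟩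
        rw [h3, neg_one_smul]
      · rw [if_neg (by omega), if_neg h, smul_zero]
  have hf := finite_support_chiHat_chiHat (s := 2 * a) (by omega) P
  have hsum : ∀ k : ℤ, ∑ᶠ c : ℤ, (if c = k then -chiHat (n + 2 * a + 1) P else 0)
      = -chiHat (n + 2 * a + 1) P := by
    intro k
    rw [finsum_eq_single _ k (fun c hc => if_neg hc), if_pos rfl]
  have hfin : ∀ k : ℤ, (Function.support fun c : ℤ =>
      if c = k then -chiHat (n + 2 * a + 1) P else 0).Finite := by
    intro k
    refine (Set.finite_singleton k).subset fun c hc => ?_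
    by_contra h
    exact hc (if_neg h)
  rw [Hhat, Hhat, map_smul, ← smul_sub, map_finsum _ hf, ← finsum_sub_distrib
    (finite_support_chiHat_chiHat (s := 2 * a) (by omega) _)
    (finite_support_linearMap_comp (chiHat n) hf), finsum_congr key, finsum_add_distrib (hfin _) (hfin _),
    hsum, hsum, ← two_smul ℂ, smul_smul]
  norm_num

/-- The shift anomaly of the Heaviside sequence on `ℤ`. -/
lemma finsum_heaviside_sub_shift (k : ℤ) (P : MvPolynomial ℕ ℂ) :
    ∑ᶠ c : ℤ, ((if c < 0 then P else 0) - (if c + k < 0 then P else 0)) = (k : ℂ) • P := by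
  rcases le_total 0 k with hk | hk
  · have h : ∀ c : ℤ, ((if c < 0 then P else 0) - (if c + k < 0 then P else 0))
        = if c ∈ Finset.Ico (-k) 0 then P else 0 := by
      intro c
      simp only [Finset.mem_Ico]
      split_ifs <;> first | omega | simp
    rw [finsum_congr h, finsum_eq_sum_of_support_subset (s := Finset.Ico (-k) 0)]
    · rw [Finset.sum_ite_mem, Finset.inter_self, Finset.sum_const, Int.card_Ico,
        ← Nat.cast_smul_eq_nsmul ℂ]
      lift k to ℕ using hk
      simp
    · intro c hc
      by_contra h'
      exact hc (if_neg h')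
  · have h : ∀ c : ℤ, ((if c < 0 then P else 0) - (if c + k < 0 then P else 0))
        = if c ∈ Finset.Ico 0 (-k) then -P else 0 := by
      intro c
      simp only [Finset.mem_Ico]
      split_ifs <;> first | omega | simp
    rw [finsum_congr h, finsum_eq_sum_of_support_subset (s := Finset.Ico 0 (-k))]
    · rw [Finset.sum_ite_mem, Finset.inter_self, Finset.sum_const, Int.card_Ico,
        ← Nat.cast_smul_eq_nsmul ℂ]
      obtain ⟨j, rfl⟩ : ∃ j : ℕ, k = -j := ⟨(-k).toNat, by omega⟩
      simp
    · intro c hc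
      by_contra h'
      exact hc (if_neg h')

lemma finsum_sub_shift_eq_zero {M : Type*} [AddCommGroup M] {f : ℤ → M}
    (hf : (Function.support f).Finite) (k : ℤ) : ∑ᶠ c : ℤ, (f c - f (c + k)) = 0 := by
  rw [finsum_sub_distrib hf (hf.preimage (add_left_injective k).injOn), sub_eq_zero]
  exact (finsum_comp_equiv (Equiv.addRight k)).symm

lemma finite_support_sub_shift {M : Type*} [AddCommGroup M] {f : ℤ → M}
    (hf : (Function.support f).Finite) (k : ℤ) :
    (Function.support fun c : ℤ => f c - f (c + k)).Finite :=
  (hf.union (hf.preimage (add_left_injective k).injOn)).subset (Function.support_sub _ _)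

/-- The sums `∑_c ± χ̂_{-1-c} χ̂_c` become locally finite after normal ordering. -/
lemma finite_support_normalOrdered (P : MvPolynomial ℕ ℂ) :
    (Function.support fun c : ℤ => (-1 : ℂ) ^ (c + 1) • chiHat (-1 - c) (chiHat c P)
      - if c < 0 then P else 0).Finite := by
  obtain ⟨N, hN⟩ := exists_forall_chiHat_eq_zero P
  refine (Set.finite_Icc (-1 - N) (max N 0)).subset fun c hc => ?_
  rw [Function.mem_support] at hc
  by_contra h
  rw [Set.mem_Icc] at h
  apply hc
  by_cases h1 : max N 0 ≤ c
  · rw [hN c (by omega), map_zero, smul_zero, if_neg (by omega), sub_zero]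
  · have h2 := chiHat_commutator (-1 - c) c P
    rw [hN (-1 - c) (by omega), map_zero, sub_zero, if_pos (by ring)] at h2
    have h3 : (-1 : ℂ) ^ (c + 1) * (-1) ^ (-1 - c) = 1 := by
      rw [← zpow_add₀ (by norm_num), show c + 1 + (-1 - c) = 0 by ring, zpow_zero]
    rw [h2, smul_smul, h3, one_smul, if_pos (by omega), sub_self]

/-- The twisted Heisenberg relation `[Ĥ_a, Ĥ_b] = -(a + 1/2) δ_{a+b+1,0}`. -/
lemma Hhat_commutator (a b : ℤ) (P : MvPolynomial ℕ ℂ) :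
    Hhat a (Hhat b P) - Hhat b (Hhat a P)
      = if a + b + 1 = 0 then -((a : ℂ) + 1 / 2) • P else 0 := by
  set g : ℤ → MvPolynomial ℕ ℂ := fun c =>
    (-1 : ℂ) ^ (c + 1) • chiHat (2 * a + 2 * b + 1 - c) (chiHat c P) with hg
  have key : ∀ c : ℤ, Hhat a ((-1 : ℂ) ^ (c + 1) • chiHat (2 * b - c) (chiHat c P))
      - (-1 : ℂ) ^ (c + 1) • chiHat (2 * b - c) (chiHat c (Hhat a P))
      = (-1 : ℂ) • (g c - g (c + (2 * a + 1))) := by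
    intro c
    have h1 := Hhat_chiHat_commutator a (2 * b - c) (chiHat c P)
    have h2 := Hhat_chiHat_commutator a c P
    rw [sub_eq_iff_eq_add] at h1 h2
    have h3 : (-1 : ℂ) ^ (c + (2 * a + 1) + 1) = -(-1) ^ (c + 1) := by
      rw [show c + (2 * a + 1) + 1 = (c + 1) + (2 * a + 1) by ring, zpow_add₀ (by norm_num),
        Odd.neg_one_zpow ⟨a, rfl⟩, mul_neg_one]
    simp only [hg]
    rw [Hhat_smul, h1, h2, map_add, map_neg, h3,
      show 2 * b - c + 2 * a + 1 = 2 * a + 2 * b + 1 - c by ring,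
      show 2 * a + 2 * b + 1 - (c + (2 * a + 1)) = 2 * b - c by ring,
      show c + 2 * a + 1 = c + (2 * a + 1) by ring]
    module
  have hf := finite_support_chiHat_chiHat (s := 2 * b) (by omega) P
  have hstep : Hhat a (Hhat b P) - Hhat b (Hhat a P)
      = (-1 / 2 : ℂ) • ∑ᶠ c : ℤ, (g c - g (c + (2 * a + 1))) := by
    rw [Hhat.eq_1 b, Hhat.eq_1 b, Hhat_smul, ← smul_sub, ← HhatLinear_apply,
      map_finsum _ hf, ← finsum_sub_distrib
      (finite_support_linearMap_comp (HhatLinear a) hf)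
      (finite_support_chiHat_chiHat (s := 2 * b) (by omega) _)]
    simp only [HhatLinear_apply]
    rw [finsum_congr key, ← smul_finsum, smul_smul]
    norm_num
  rw [hstep]
  split_ifs with h
  · set f : ℤ → MvPolynomial ℕ ℂ := fun c => g c - if c < 0 then P else 0 with hfdef
    have hfin : (Function.support f).Finite := by
      simp only [hfdef, hg]
      rw [show 2 * a + 2 * b + 1 = -1 by omega]
      exact finite_support_normalOrdered P
    have hsplit : ∀ c : ℤ, g c - g (c + (2 * a + 1)) = (f c - f (c + (2 * a + 1)))
        + ((if c < 0 then P else 0) - (if c + (2 * a + 1) < 0 then P else 0)) := by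
      intro c
      simp only [hfdef]
      abel
    have hheav : (Function.support fun c : ℤ =>
        ((if c < 0 then P else 0) - (if c + (2 * a + 1) < 0 then P else 0))).Finite := by
      refine (Set.finite_Icc (-|2 * a + 1|) |2 * a + 1|).subset fun c hc => ?_
      rw [Function.mem_support] at hc
      by_contra h'
      rw [Set.mem_Icc] at h'
      apply hc
      have := le_abs_self (2 * a + 1)
      have := neg_abs_le (2 * a + 1)
      split_ifs <;> first | omega | simp
    rw [finsum_congr hsplit, finsum_add_distrib (finite_support_sub_shift hfin _) hheav,
      finsum_sub_shift_eq_zero hfin, finsum_heaviside_sub_shift, zero_add, smul_smul]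
    congr 1
    push_cast
    ring
  · rw [finsum_sub_shift_eq_zero (finite_support_chiHat_chiHat (by omega) P), smul_zero]

lemma finite_support_Hhat (P : MvPolynomial ℕ ℂ) :
    (Function.support fun b : ℕ => Hhat (-(b : ℤ) - 1) (Hhat (b : ℤ) P)).Finite := by
  obtain ⟨N, hN⟩ := exists_forall_chiHat_eq_zero P
  refine (Set.finite_Iio N.toNat).subset fun b hb => ?_
  rw [Function.mem_support] at hb
  by_contra h
  rw [Set.mem_Iio] at h
  apply hb
  have h0 : Hhat (b : ℤ) P = 0 := by
    rw [Hhat, finsum_eq_zero_of_forall_eq_zero, smul_zero]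
    intro c
    by_cases h1 : N ≤ c
    · rw [hN c h1, map_zero, smul_zero]
    · rw [chiHat_comm (by omega), hN _ (by omega), map_zero, smul_zero]
  rw [h0, Hhat_zero]

/-- **`[L^t_0, h^t_n] = −n h^t_n` for all `n ∈ ℤ+1/2`:** for every `a ∈ ℤ`,
`L^t_0 ∘ Ĥ_a − Ĥ_a ∘ L^t_0 = −(a + 1/2) • Ĥ_a`. -/
theorem ckp_Lt0_twisted_heisenberg_commutator (a : ℤ) (P : MvPolynomial ℕ ℂ) :
    Lt0 (Hhat a P) - Hhat a (Lt0 P) = -((a : ℂ) + 1/2) • Hhat a P := by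
  have key : ∀ b : ℕ, Hhat (-(b : ℤ) - 1) (Hhat (b : ℤ) (Hhat a P))
      - Hhat a (Hhat (-(b : ℤ) - 1) (Hhat (b : ℤ) P))
      = if b = (if 0 ≤ a then a else -a - 1).toNat then ((a : ℂ) + 1 / 2) • Hhat a P else 0 := by
    intro b
    have h1 := Hhat_commutator b a P
    have h2 := Hhat_commutator (-(b : ℤ) - 1) a (Hhat b P)
    rw [sub_eq_iff_eq_add] at h1
    rw [h1, Hhat_add, add_sub_assoc, h2]
    by_cases ha : 0 ≤ a
    · lift a to ℕ using ha
      rw [if_neg (by omega), Hhat_zero, zero_add]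
      by_cases hb : b = a
      · subst hb
        rw [if_pos (by ring), if_pos (by simp)]
        congr 1
        push_cast
        ring
      · rw [if_neg (by omega), if_neg (by simpa using hb)]
    · obtain ⟨d, rfl⟩ : ∃ d : ℕ, a = -(d : ℤ) - 1 := ⟨(-a - 1).toNat, by omega⟩
      rw [if_neg (c := -(b : ℤ) - 1 + (-(d : ℤ) - 1) + 1 = 0) (by omega), add_zero, if_neg ha]
      by_cases hb : b = d
      · subst hb
        rw [if_pos (by ring), if_pos (by omega), Hhat_smul]
        congr 1
        push_cast
        ring
      · rw [if_neg (by omega), if_neg (by omega), Hhat_zero]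
  have hf := finite_support_Hhat P
  rw [Lt0, Lt0, ← HhatLinear_apply a (-_), map_neg, map_finsum _ hf, neg_sub_neg,
    ← neg_sub, ← finsum_sub_distrib (finite_support_Hhat _)
      (finite_support_linearMap_comp (HhatLinear a) hf)]
  simp only [HhatLinear_apply]
  rw [finsum_congr key, finsum_eq_single _ _ (fun b hb => if_neg hb), if_pos rfl, neg_smul]
end
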